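/- Let u, w : ℝ × ℝ → ℝ be smooth and spatially periodic with μ(w)(t) − w_xx(t,x) = u(t,x) for all (t,x), and suppose u satisfies the μDP equation μ(u_t)(t) − u_txx + 3μ(u)(t) u_x − 3u_x u_xx − u u_xxx = 0 at every point. Then the functional H₂(t) = −∫₀¹ ( (3/2) μ(u)(t) · w_x(t,x)² + u(t,x)³/6 ) dx is constant in t. -/

import Mathlib

open intervalIntegral

/-- Partial derivative in the second (spatial) variable. -/
noncomputable def pdx (u : ℝ × ℝ → ℝ) : ℝ × ℝ → ℝ := fun p => deriv (fun y => u (p.1, y)) p.2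

/-- Partial derivative in the first (time) variable. -/
noncomputable def pdt (u : ℝ × ℝ → ℝ) : ℝ × ℝ → ℝ := fun p => deriv (fun s => u (s, p.2)) p.1

/-- The spatial mean `μ(u)(t) = ∫₀¹ u(t,x) dx`. -/
noncomputable def muMean (u : ℝ × ℝ → ℝ) (t : ℝ) : ℝ := ∫ x in (0:ℝ)..1, u (t, x)

theorem hasDerivAt_space_fderiv {f : ℝ × ℝ → ℝ} (hf : ContDiff ℝ (⊤ : ℕ∞) f) (t x : ℝ) :
    HasDerivAt (fun y => f (t, y)) (fderiv ℝ f (t, x) (0, 1)) x :=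
  ((hf.differentiable (by simp) (t, x)).hasFDerivAt).comp_hasDerivAt x
    ((hasDerivAt_const x t).prodMk (hasDerivAt_id x))

theorem hasDerivAt_time_fderiv {f : ℝ × ℝ → ℝ} (hf : ContDiff ℝ (⊤ : ℕ∞) f) (t x : ℝ) :
    HasDerivAt (fun s => f (s, x)) (fderiv ℝ f (t, x) (1, 0)) t :=
  ((hf.differentiable (by simp) (t, x)).hasFDerivAt).comp_hasDerivAt t
    ((hasDerivAt_id t).prodMk (hasDerivAt_const t x))

theorem pdx_eq_fderiv {f : ℝ × ℝ → ℝ} (hf : ContDiff ℝ (⊤ : ℕ∞) f) :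
    pdx f = fun p => fderiv ℝ f p (0, 1) :=
  funext fun p => (hasDerivAt_space_fderiv hf p.1 p.2).deriv

theorem pdt_eq_fderiv {f : ℝ × ℝ → ℝ} (hf : ContDiff ℝ (⊤ : ℕ∞) f) :
    pdt f = fun p => fderiv ℝ f p (1, 0) :=
  funext fun p => (hasDerivAt_time_fderiv hf p.1 p.2).deriv

theorem hasDerivAt_pdx {f : ℝ × ℝ → ℝ} (hf : ContDiff ℝ (⊤ : ℕ∞) f) (t x : ℝ) :
    HasDerivAt (fun y => f (t, y)) (pdx f (t, x)) x := by
  rw [pdx_eq_fderiv hf]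
  exact hasDerivAt_space_fderiv hf t x

theorem hasDerivAt_pdt {f : ℝ × ℝ → ℝ} (hf : ContDiff ℝ (⊤ : ℕ∞) f) (t x : ℝ) :
    HasDerivAt (fun s => f (s, x)) (pdt f (t, x)) t := by
  rw [pdt_eq_fderiv hf]
  exact hasDerivAt_time_fderiv hf t x

theorem contDiff_pdx {f : ℝ × ℝ → ℝ} (hf : ContDiff ℝ (⊤ : ℕ∞) f) :
    ContDiff ℝ (⊤ : ℕ∞) (pdx f) := by
  rw [pdx_eq_fderiv hf]
  exact (hf.fderiv_right (by simp)).clm_apply contDiff_const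

theorem contDiff_pdt {f : ℝ × ℝ → ℝ} (hf : ContDiff ℝ (⊤ : ℕ∞) f) :
    ContDiff ℝ (⊤ : ℕ∞) (pdt f) := by
  rw [pdt_eq_fderiv hf]
  exact (hf.fderiv_right (by simp)).clm_apply contDiff_const

theorem pdx_pdt_comm {f : ℝ × ℝ → ℝ} (hf : ContDiff ℝ (⊤ : ℕ∞) f) :
    pdx (pdt f) = pdt (pdx f) := by
  have hd : Differentiable ℝ (fderiv ℝ f) :=
    (hf.fderiv_right (m := (⊤ : ℕ∞)) (by simp)).differentiable (by simp)
  rw [pdx_eq_fderiv (contDiff_pdt hf), pdt_eq_fderiv (contDiff_pdx hf),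
    pdx_eq_fderiv hf, pdt_eq_fderiv hf]
  funext p
  have hsymm : IsSymmSndFDerivAt ℝ f p :=
    hf.contDiffAt.isSymmSndFDerivAt (by simpa using WithTop.coe_le_coe.2 (le_top (a := (2 : ℕ∞))))
  rw [fderiv_clm_apply (hd p) (by fun_prop), fderiv_clm_apply (hd p) (by fun_prop)]
  simpa using hsymm.eq (0, 1) (1, 0)

theorem pdx_periodic {f : ℝ × ℝ → ℝ} (hp : ∀ t x, f (t, x + 1) = f (t, x)) (t x : ℝ) :
    pdx f (t, x + 1) = pdx f (t, x) := by
  unfold pdx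
  rw [← deriv_comp_add_const]
  simp only [hp]

theorem pdt_periodic {f : ℝ × ℝ → ℝ} (hp : ∀ t x, f (t, x + 1) = f (t, x)) (t x : ℝ) :
    pdt f (t, x + 1) = pdt f (t, x) := by
  unfold pdt
  simp only [hp]

/-- Differentiation under the integral sign for the spatial mean. -/
theorem hasDerivAt_muMean {f : ℝ × ℝ → ℝ} (hf : ContDiff ℝ (⊤ : ℕ∞) f) (t : ℝ) :
    HasDerivAt (muMean f) (muMean (pdt f) t) t := by
  have hc := hf.continuous
  have hc' := (contDiff_pdt hf).continuous
  obtain ⟨C, hC⟩ := ((isCompact_closedBall t 1).prod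
    (isCompact_Icc (a := (0:ℝ)) (b := 1))).exists_bound_of_continuousOn hc'.continuousOn
  refine (intervalIntegral.hasDerivAt_integral_of_dominated_loc_of_deriv_le (F := fun s x => f (s, x))
    (F' := fun s x => pdt f (s, x)) (bound := fun _ => C)
    (Metric.closedBall_mem_nhds t one_pos) ?_ ?_ ?_ ?_ ?_ ?_).2
  · exact .of_forall fun s => Continuous.aestronglyMeasurable (by fun_prop)
  · exact Continuous.intervalIntegrable (by fun_prop) _ _
  · exact Continuous.aestronglyMeasurable (by fun_prop)
  · refine .of_forall fun x hx s hs => hC (s, x) ⟨hs, ?_⟩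
    rw [Set.uIoc_of_le zero_le_one] at hx
    exact ⟨hx.1.le, hx.2⟩
  · exact _root_.intervalIntegrable_const
  · exact .of_forall fun x _ s _ => hasDerivAt_pdt hf s x

theorem integral_eq_zero_of_periodic_primitive {f f' : ℝ → ℝ}
    (h : ∀ x, HasDerivAt f (f' x) x) (hc : Continuous f') (hp : ∀ x, f (x + 1) = f x) :
    ∫ x in (0:ℝ)..1, f' x = 0 := by
  rw [integral_eq_sub_of_hasDerivAt (fun x _ => h x) (hc.intervalIntegrable _ _)]
  simpa [sub_eq_zero] using hp 0

theorem muMean_pdx_eq_zero {f : ℝ × ℝ → ℝ} (hf : ContDiff ℝ (⊤ : ℕ∞) f)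
    (hp : ∀ t x, f (t, x + 1) = f (t, x)) (t : ℝ) : muMean (pdx f) t = 0 := by
  have hc := (contDiff_pdx hf).continuous
  exact integral_eq_zero_of_periodic_primitive (hasDerivAt_pdx hf t) (by fun_prop) (hp t)

theorem exists_eq_const_of_hasDerivAt_zero {g : ℝ → ℝ} (h : ∀ x, HasDerivAt g 0 x) :
    ∃ c, ∀ x, g x = c :=
  ⟨g 0, fun x => is_const_of_deriv_eq_zero (fun y => (h y).differentiableAt)
    (fun y => (h y).deriv) x 0⟩

/-- A periodic function with constant derivative and zero mean vanishes. -/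
theorem eq_zero_of_hasDerivAt_const {g : ℝ → ℝ} {c : ℝ} (h : ∀ x, HasDerivAt g c x)
    (hp : ∀ x, g (x + 1) = g x) (hint : ∫ x in (0:ℝ)..1, g x = 0) (x : ℝ) : g x = 0 := by
  have hc : c = 0 := by
    simpa using integral_eq_zero_of_periodic_primitive h continuous_const hp
  subst hc
  obtain ⟨k, hk⟩ := exists_eq_const_of_hasDerivAt_zero h
  simp only [hk] at hint ⊢
  simpa using hint

/-- the Hamiltonian
`H₂ = −∫₀¹ ((3/2) μ(u) (∂_x Λ_μ⁻² u)² + u³/6) dx` is conserved by the μDP flow. -/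
theorem muDP_H2_conserved
    (u w : ℝ × ℝ → ℝ) (hu : ContDiff ℝ (⊤ : ℕ∞) u) (hw : ContDiff ℝ (⊤ : ℕ∞) w)
    (huper : ∀ t x, u (t, x + 1) = u (t, x)) (hwper : ∀ t x, w (t, x + 1) = w (t, x))
    (hinv : ∀ t x : ℝ, muMean w t - pdx (pdx w) (t, x) = u (t, x))
    (heq : ∀ t x : ℝ,
      muMean (pdt u) t - pdx (pdx (pdt u)) (t, x) + 3 * muMean u t * pdx u (t, x)
        - 3 * pdx u (t, x) * pdx (pdx u) (t, x) - u (t, x) * pdx (pdx (pdx u)) (t, x) = 0) :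
    ∀ t₁ t₂ : ℝ,
      (-∫ x in (0:ℝ)..1, (3 / 2 * muMean u t₁ * pdx w (t₁, x) ^ 2 + u (t₁, x) ^ 3 / 6))
        = -∫ x in (0:ℝ)..1, (3 / 2 * muMean u t₂ * pdx w (t₂, x) ^ 2 + u (t₂, x) ^ 3 / 6) := by
  have hux := contDiff_pdx hu
  have huxx := contDiff_pdx hux
  have hut := contDiff_pdt hu
  have hutx := contDiff_pdx hut
  have hwx := contDiff_pdx hw
  have hwt := contDiff_pdt hw
  have hflux (t x : ℝ) : HasDerivAt
      (fun y => pdx (pdt u) (t, y) - 3 * muMean u t * u (t, y) + pdx u (t, y) * pdx u (t, y)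
        + u (t, y) * pdx (pdx u) (t, y)) (muMean (pdt u) t) x := by
    refine HasDerivAt.congr_deriv ((((hasDerivAt_pdx hutx t x).sub
      ((hasDerivAt_pdx hu t x).const_mul (3 * muMean u t))).add
      ((hasDerivAt_pdx hux t x).mul (hasDerivAt_pdx hux t x))).add
      ((hasDerivAt_pdx hu t x).mul (hasDerivAt_pdx huxx t x))) ?_
    linear_combination -heq t x
  have hut_mean (t : ℝ) : muMean (pdt u) t = 0 := by
    simpa using integral_eq_zero_of_periodic_primitive (hflux t) continuous_const fun x => by
      simp only [huper, pdx_periodic huper, pdx_periodic (pdx_periodic huper),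
        pdx_periodic (pdt_periodic huper)]
  obtain ⟨m, hm⟩ : ∃ m, ∀ t, muMean u t = m :=
    exists_eq_const_of_hasDerivAt_zero fun t => hut_mean t ▸ hasDerivAt_muMean hu t
  have hwm (t : ℝ) : muMean w t = m := by
    have hcu := hu.continuous
    have h0 := muMean_pdx_eq_zero hwx (pdx_periodic hwper) t
    have h1 (x : ℝ) : pdx (pdx w) (t, x) = muMean w t - u (t, x) := by
      linear_combination -hinv t x
    unfold muMean at h0
    simp only [h1] at h0
    rw [integral_sub _root_.intervalIntegrable_const
      (Continuous.intervalIntegrable (by fun_prop) _ _)] at h0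
    have h2 : ∫ x in (0:ℝ)..1, u (t, x) = m := hm t
    rw [h2] at h0
    simpa [sub_eq_zero] using h0
  have hwxx : pdx (pdx w) = fun p => m - u p := by
    funext ⟨t, x⟩
    linear_combination -hinv t x + hwm t
  have hwtxx (t x : ℝ) : pdx (pdx (pdt w)) (t, x) = -pdt u (t, x) := by
    rw [pdx_pdt_comm hw, pdx_pdt_comm hwx, hwxx]
    exact ((hasDerivAt_pdt hu t x).const_sub m).deriv
  have hevol (t x : ℝ) : pdt u (t, x) + 3 * m * pdx w (t, x) + u (t, x) * pdx u (t, x) = 0 := by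
    obtain ⟨c, hc⟩ := exists_eq_const_of_hasDerivAt_zero fun x => hut_mean t ▸ hflux t x
    refine eq_zero_of_hasDerivAt_const (c := c + 3 * m * m)
      (g := fun x => pdt u (t, x) + 3 * m * pdx w (t, x) + u (t, x) * pdx u (t, x))
      (fun y => ?_) (fun y => ?_) ?_ x
    · refine HasDerivAt.congr_deriv
        (((hasDerivAt_pdx hut t y).add ((hasDerivAt_pdx hwx t y).const_mul (3 * m))).add
        ((hasDerivAt_pdx hu t y).mul (hasDerivAt_pdx hux t y))) ?_
      rw [hwxx, ← hc y, hm]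
      ring
    · simp only [huper, pdx_periodic huper, pdx_periodic hwper, pdt_periodic huper]
    · have hcut := hut.continuous
      have hcwx := hwx.continuous
      have hcu := hu.continuous
      have hcux := hux.continuous
      have huux : ∫ x in (0:ℝ)..1, u (t, x) * pdx u (t, x) = 0 :=
        integral_eq_zero_of_periodic_primitive (f := fun x => u (t, x) ^ 2 / 2)
          (fun y => by
            refine HasDerivAt.congr_deriv (((hasDerivAt_pdx hu t y).pow 2).div_const 2) ?_
            ring) (by fun_prop) (fun y => by rw [huper])
      have h1 : ∫ x in (0:ℝ)..1, pdt u (t, x) = 0 := hut_mean t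
      have h2 : ∫ x in (0:ℝ)..1, pdx w (t, x) = 0 := muMean_pdx_eq_zero hw hwper t
      rw [integral_add (Continuous.intervalIntegrable (by fun_prop) _ _)
        (Continuous.intervalIntegrable (by fun_prop) _ _),
        integral_add (Continuous.intervalIntegrable (by fun_prop) _ _)
        (Continuous.intervalIntegrable (by fun_prop) _ _), integral_const_mul, h1, h2, huux]
      ring
  have hwtx (t : ℝ) : ∃ e, ∀ x,
      pdx (pdt w) (t, x) - 3 * m * w (t, x) - u (t, x) ^ 2 / 2 = e := by
    refine exists_eq_const_of_hasDerivAt_zero fun x => ?_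
    refine HasDerivAt.congr_deriv (((hasDerivAt_pdx (contDiff_pdx hwt) t x).sub
      ((hasDerivAt_pdx hw t x).const_mul (3 * m))).sub
      (((hasDerivAt_pdx hu t x).pow 2).div_const 2)) ?_
    rw [hwtxx]
    linear_combination -hevol t x
  set h : ℝ × ℝ → ℝ := fun p => 3 / 2 * m * pdx w p ^ 2 + u p ^ 3 / 6 with h_def
  have hh : ContDiff ℝ (⊤ : ℕ∞) h := by
    rw [h_def]
    fun_prop
  have hh_mean (t : ℝ) : muMean (pdt h) t = 0 := by
    obtain ⟨e, he⟩ := hwtx t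
    have hc := (contDiff_pdt hh).continuous
    refine integral_eq_zero_of_periodic_primitive
      (f := fun x => 9 / 2 * m ^ 2 * w (t, x) ^ 2 + 3 * m * e * w (t, x) - u (t, x) ^ 4 / 8)
      (fun x => ?_) (by fun_prop) (fun x => by rw [huper, hwper])
    have hht : pdt h (t, x)
        = 3 * m * pdx w (t, x) * pdx (pdt w) (t, x) + u (t, x) ^ 2 * pdt u (t, x) / 2 := by
      refine HasDerivAt.deriv ?_
      refine HasDerivAt.congr_deriv ((((hasDerivAt_pdt hwx t x).pow 2).const_mul (3 / 2 * m)).add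
        (((hasDerivAt_pdt hu t x).pow 3).div_const 6)) ?_
      rw [pdx_pdt_comm hw]
      push_cast
      ring
    refine HasDerivAt.congr_deriv (((((hasDerivAt_pdx hw t x).pow 2).const_mul (9 / 2 * m ^ 2)).add
      ((hasDerivAt_pdx hw t x).const_mul (3 * m * e))).sub
      (((hasDerivAt_pdx hu t x).pow 4).div_const 8)) ?_
    rw [hht]
    push_cast
    linear_combination -(3 * m * pdx w (t, x) * he x) - u (t, x) ^ 2 / 2 * hevol t x
  obtain ⟨k, hk⟩ := exists_eq_const_of_hasDerivAt_zero fun t => hh_mean t ▸ hasDerivAt_muMean hh t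
  intro t₁ t₂
  rw [hm, hm]
  exact congrArg Neg.neg ((hk t₁).trans (hk t₂).symm)
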